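/- arXiv:0810.2919 — 2 statements merged into one kernel-verified Lean document; each statement's English description precedes it below -/
import Mathlib

section
/- The number of sign sequences in {+,−}^n with exactly r occurrences of the consecutive pattern '+−' and ending in '−' is C(n, 2r), and the number with exactly r−1 occurrences of '+−' and ending in '+' is C(n, 2r−1); in total C(n,2r)+C(n,2r−1) = C(n+1,2r). -/
/-- The number of indices at which `s` steps from `true` to `false`. -/
def numDescents {n : ℕ} (s : Fin (n + 1) → Bool) : ℕ :=
  ∑ i : Fin n, if s i.castSucc = true ∧ s i.succ = false then 1 else 0

theorem numDescents_snoc {n : ℕ} (s : Fin (n + 1) → Bool) (b : Bool) :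
    numDescents (Fin.snoc s b : Fin (n + 2) → Bool) =
      numDescents s + if s (Fin.last n) = true ∧ b = false then 1 else 0 := by
  unfold numDescents
  rw [Fin.sum_univ_castSucc]
  simp only [Fin.succ_castSucc, Fin.snoc_castSucc, Fin.succ_last, Fin.snoc_last]

theorem card_filter_snoc {n : ℕ} (p : (Fin (n + 1) → Bool) → Prop) [DecidablePred p] :
    (Finset.univ.filter p).card =
      (Finset.univ.filter fun s : Fin n → Bool => p (Fin.snoc s true)).card +
        (Finset.univ.filter fun s : Fin n → Bool => p (Fin.snoc s false)).card := by
  simp only [Finset.card_filter]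
  rw [← (Fin.snocEquiv fun _ : Fin (n + 1) => Bool).sum_comp, Fintype.sum_prod_type,
    Fintype.sum_bool]
  rfl

theorem card_filter_eq_last_add {n : ℕ} (p : (Fin (n + 1) → Bool) → Prop) [DecidablePred p] :
    (Finset.univ.filter p).card =
      (Finset.univ.filter fun s => p s ∧ s (Fin.last n) = true).card +
        (Finset.univ.filter fun s => p s ∧ s (Fin.last n) = false).card := by
  rw [← Finset.card_filter_add_card_filter_not (s := Finset.univ.filter p)
    (fun s => s (Fin.last n) = true)]
  simp only [Finset.filter_filter, Bool.not_eq_true]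

theorem card_numDescents_eq_and_last_eq (n k : ℕ) (b : Bool) :
    (Finset.univ.filter fun s : Fin (n + 1) → Bool =>
      numDescents s = k ∧ s (Fin.last n) = b).card = (n + 1).choose (2 * k + b.toNat) := by
  induction n generalizing k b with
  | zero =>
    rw [card_filter_snoc]
    rcases k with _ | k <;> cases b <;>
      simp [numDescents, Fin.snoc, Nat.choose_eq_zero_of_lt, Nat.mul_add]
  | succ n ih =>
    rw [card_filter_snoc]
    simp only [numDescents_snoc, Fin.snoc_last]
    cases b
    · simp only [Bool.true_eq_false, and_false, Finset.filter_false, Finset.card_empty, zero_add,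
        and_true]
      rw [card_filter_eq_last_add]
      have hf := ih k false
      have hfalse : ∀ s : Fin (n + 1) → Bool,
          (numDescents s + (if s (Fin.last n) = true then 1 else 0) = k ∧
            s (Fin.last n) = false) ↔ (numDescents s = k ∧ s (Fin.last n) = false) := by
        intro s; cases s (Fin.last n) <;> simp
      have htrue : ∀ s : Fin (n + 1) → Bool,
          (numDescents s + (if s (Fin.last n) = true then 1 else 0) = k ∧
            s (Fin.last n) = true) ↔ (numDescents s + 1 = k ∧ s (Fin.last n) = true) := by
        intro s; cases s (Fin.last n) <;> simp
      simp only [hfalse, htrue, hf]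
      rcases k with _ | k
      · simp
      · have ht := ih k true
        simp only [Nat.add_right_cancel_iff, ht, Bool.toNat_true, Bool.toNat_false]
        exact (Nat.choose_succ_succ _ _).symm
    · simp only [Bool.true_eq_false, Bool.false_eq_true, and_false, Finset.filter_false,
        Finset.card_empty, add_zero, and_true, if_false]
      rw [card_filter_eq_last_add, ih, ih, add_comm]
      exact (Nat.choose_succ_succ _ _).symm

theorem card_filter_descent_eq_numDescents {n : ℕ} (s : Fin (n + 1) → Bool) :
    (Finset.univ.filter fun i : Fin (n + 1) => i.val + 1 < n + 1 ∧ s i = true ∧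
      s ⟨min (i.val + 1) (n + 1 - 1), by omega⟩ = false).card = numDescents s := by
  rw [Finset.card_filter, Fin.sum_univ_castSucc, numDescents]
  simp only [Fin.val_last, lt_irrefl, false_and, if_false, add_zero]
  refine Finset.sum_congr rfl fun i _ => ?_
  have h : (⟨min (i.castSucc.val + 1) (n + 1 - 1), by omega⟩ : Fin (n + 1)) = i.succ := by
    ext; simp
  simp only [h]
  simp


/-- Counting sign sequences `s ∈ {+,−}^n` (`true` = `+`) by occurrences of the
consecutive pattern `+−` (an index `i` with `sᵢ = +`, `sᵢ₊₁ = −`): for `r ≥ 1`,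
the number of sequences with exactly `r` occurrences of `+−` ending in `−` is
`C(n, 2r)`; the number with exactly `r−1` occurrences of `+−` ending in `+` is
`C(n, 2r−1)`; and in total `C(n,2r) + C(n,2r−1) = C(n+1,2r)`. -/
theorem count_sign_sequences_by_descents (n r : ℕ) (hn : 1 ≤ n) (hr : 1 ≤ r) :
    (((Finset.univ : Finset (Fin n → Bool)).filter
        (fun s => (Finset.univ.filter (fun i : Fin n =>
            i.val + 1 < n ∧ s i = true ∧
              s ⟨min (i.val + 1) (n - 1), by omega⟩ = false)).card = r
          ∧ s ⟨n - 1, by omega⟩ = false)).card = Nat.choose n (2 * r)) ∧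
    (((Finset.univ : Finset (Fin n → Bool)).filter
        (fun s => (Finset.univ.filter (fun i : Fin n =>
            i.val + 1 < n ∧ s i = true ∧
              s ⟨min (i.val + 1) (n - 1), by omega⟩ = false)).card = r - 1
          ∧ s ⟨n - 1, by omega⟩ = true)).card = Nat.choose n (2 * r - 1)) ∧
    Nat.choose n (2 * r) + Nat.choose n (2 * r - 1) = Nat.choose (n + 1) (2 * r) := by
  obtain ⟨n, rfl⟩ := Nat.exists_eq_add_of_le' hn
  obtain ⟨r, rfl⟩ := Nat.exists_eq_add_of_le' hr
  simp only [card_filter_descent_eq_numDescents]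
  refine ⟨card_numDescents_eq_and_last_eq n (r + 1) false,
    card_numDescents_eq_and_last_eq n r true, ?_⟩
  rw [add_comm]
  exact (Nat.choose_succ_succ _ _).symm
end

section
/- For a Z-grading of a simple Lie algebra g, writing the upper covering polynomial of the poset Δ(1) as K(t) = a_0 + a_1 t + a_2 t^2 + a_3 t^3 (its degree is at most 3), one has 2·dim g(1) − #E(1) = 2 + a_1 − a_3. -/
open scoped Classical

/-- A (reduced, crystallographic) simple root system of rank `n`, realized in `ℝ^n`
with the standard inner product `Σ αₜβₜ`, together with a choice of base (simple
roots) `sroot`. -/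
structure SimpleRootSystem (n : ℕ) where
  Δ : Finset (Fin n → ℝ)
  sroot : Fin n → Fin n → ℝ
  sroot_mem : ∀ i, sroot i ∈ Δ
  sroot_indep : LinearIndependent ℝ sroot
  nonzero : ∀ α ∈ Δ, α ≠ (0 : Fin n → ℝ)
  reflect : ∀ α ∈ Δ, ∀ β ∈ Δ,
    β - ((2 * (∑ t, α t * β t) / (∑ t, α t * α t)) • α) ∈ Δ
  integral : ∀ α ∈ Δ, ∀ β ∈ Δ,
    ∃ z : ℤ, (z : ℝ) * (∑ t, α t * α t) = 2 * (∑ t, α t * β t)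
  reduced : ∀ α ∈ Δ, ∀ c : ℝ, c • α ∈ Δ → c = 1 ∨ c = -1
  base : ∀ α ∈ Δ, (∃ c : Fin n → ℕ, α = ∑ i, (c i : ℝ) • sroot i) ∨
      (∃ c : Fin n → ℕ, α = -(∑ i, (c i : ℝ) • sroot i))
  irreducible : ∀ s : Finset (Fin n),
      (∀ i ∈ s, ∀ j ∉ s, (∑ t, sroot i t * sroot j t) = 0) → s = ∅ ∨ s = Finset.univ

/-- The set of roots of degree `d` for the standard `ℤ`-grading determined by the
colored set `s` of simple roots. -/
noncomputable def graded {n : ℕ} (R : SimpleRootSystem n) (s : Finset (Fin n)) (d : ℕ) :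
    Finset (Fin n → ℝ) :=
  R.Δ.filter (fun γ => ∃ c : Fin n → ℕ,
    γ = ∑ i, (c i : ℝ) • R.sroot i ∧ ∑ i ∈ s, c i = d)

/-- The Hasse edges of `Δ(d)`: pairs `(μ, i)` with `μ ∈ Δ(d)`, `αᵢ` a simple root of
`g(0)` (uncolored), and `μ − αᵢ ∈ Δ(d)`. -/
noncomputable def gradedEdges {n : ℕ} (R : SimpleRootSystem n) (s : Finset (Fin n))
    (d : ℕ) : Finset ((Fin n → ℝ) × Fin n) :=
  (graded R s d ×ˢ sᶜ).filter (fun p => p.1 - R.sroot p.2 ∈ graded R s d)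

/-- The coefficient `a_j` of the upper covering polynomial of `Δ(1)`: the number of
elements of `Δ(1)` covering exactly `j` elements of `Δ(1)`. -/
noncomputable def ucpCoeff {n : ℕ} (R : SimpleRootSystem n) (s : Finset (Fin n))
    (j : ℕ) : ℕ :=
  ((graded R s 1).filter (fun μ =>
    ((sᶜ : Finset (Fin n)).filter (fun i => μ - R.sroot i ∈ graded R s 1)).card = j)).card

section RealVectors

open Matrix

variable {n : ℕ}

theorem dotProduct_self_pos_of_ne_zero {v : Fin n → ℝ} (hv : v ≠ 0) : 0 < v ⬝ᵥ v := by
  have h0 : 0 ≤ v ⬝ᵥ v := Finset.sum_nonneg fun t _ => mul_self_nonneg (v t)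
  exact lt_of_le_of_ne h0 fun h => hv (dotProduct_self_eq_zero.1 h.symm)

theorem sub_dotProduct_sub_self (v w : Fin n → ℝ) :
    (v - w) ⬝ᵥ (v - w) = v ⬝ᵥ v - 2 * (v ⬝ᵥ w) + w ⬝ᵥ w := by
  simp only [sub_dotProduct, dotProduct_sub, dotProduct_comm w v]
  ring

theorem sq_dotProduct_le (v w : Fin n → ℝ) : (v ⬝ᵥ w) ^ 2 ≤ (v ⬝ᵥ v) * (w ⬝ᵥ w) := by
  have h := Finset.sum_mul_sq_le_sq_mul_sq Finset.univ v w
  simpa only [dotProduct, sq] using h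

end RealVectors

namespace SimpleRootSystem

open Matrix

variable {n : ℕ} (R : SimpleRootSystem n)

theorem self_pos {α : Fin n → ℝ} (hα : α ∈ R.Δ) : 0 < α ⬝ᵥ α :=
  dotProduct_self_pos_of_ne_zero (R.nonzero α hα)

theorem exists_int_mul {α β : Fin n → ℝ} (hα : α ∈ R.Δ) (hβ : β ∈ R.Δ) :
    ∃ z : ℤ, (z : ℝ) * (α ⬝ᵥ α) = 2 * (α ⬝ᵥ β) :=
  R.integral α hα β hβ

theorem reflect_mem {α β : Fin n → ℝ} (hα : α ∈ R.Δ) (hβ : β ∈ R.Δ) {z : ℝ}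
    (hz : z * (α ⬝ᵥ α) = 2 * (α ⬝ᵥ β)) : β - z • α ∈ R.Δ := by
  have h := R.reflect α hα β hβ
  have e : 2 * (∑ t, α t * β t) / (∑ t, α t * α t) = z := by
    exact (div_eq_iff (R.self_pos hα).ne').2 hz.symm
  rwa [e] at h

theorem neg_mem {α : Fin n → ℝ} (hα : α ∈ R.Δ) : -α ∈ R.Δ := by
  have h := R.reflect_mem hα hα (z := 2) rfl
  have e : α - (2 : ℝ) • α = -α := by rw [two_smul]; abel
  rwa [e] at h

theorem sub_mem_of_pos {α β : Fin n → ℝ} (hα : α ∈ R.Δ) (hβ : β ∈ R.Δ) (hne : α ≠ β)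
    (hpos : 0 < α ⬝ᵥ β) : α - β ∈ R.Δ := by
  obtain ⟨y, hy⟩ := R.exists_int_mul hα hβ
  obtain ⟨z, hz⟩ := R.exists_int_mul hβ hα
  have hA := R.self_pos hα
  have hB := R.self_pos hβ
  have hD := dotProduct_self_pos_of_ne_zero (sub_ne_zero.2 hne)
  rw [sub_dotProduct_sub_self] at hD
  have hz' := hz
  rw [dotProduct_comm β α] at hz
  have y0 : 1 ≤ y := by
    have : (0 : ℝ) < y := pos_of_mul_pos_left (by rw [hy]; linarith) hA.le
    exact_mod_cast this
  have z0 : 1 ≤ z := by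
    have : (0 : ℝ) < z := pos_of_mul_pos_left (by rw [hz]; linarith) hB.le
    exact_mod_cast this
  rcases y0.eq_or_lt with rfl | y1
  · have h := R.neg_mem (R.reflect_mem hα hβ hy)
    simpa using h
  rcases z0.eq_or_lt with rfl | z1
  · simpa using R.reflect_mem hβ hα hz'
  have y2 : (2 : ℝ) ≤ y := by exact_mod_cast y1
  have z2 : (2 : ℝ) ≤ z := by exact_mod_cast z1
  nlinarith

theorem add_mem_of_neg {α β : Fin n → ℝ} (hα : α ∈ R.Δ) (hβ : β ∈ R.Δ) (hne : α + β ≠ 0)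
    (hneg : α ⬝ᵥ β < 0) : α + β ∈ R.Δ := by
  have h := R.sub_mem_of_pos hα (R.neg_mem hβ) (fun h => hne (by rw [h]; simp))
    (by rw [dotProduct_neg]; linarith)
  simpa using h

/-- If three roots and their total sum are roots, then one of two given partial sums is
a root, unless one of the partial sums vanishes. -/
theorem add_mem_or_add_mem {a b c : Fin n → ℝ} (ha : a ∈ R.Δ) (hb : b ∈ R.Δ) (hc : c ∈ R.Δ)
    (habc : a + b + c ∈ R.Δ) (hbc : b + c ≠ 0) (hab : a + b ≠ 0) (hac : a + c ≠ 0) :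
    a + b ∈ R.Δ ∨ a + c ∈ R.Δ := by
  by_contra! h
  obtain ⟨h1, h2⟩ := h
  have e1 : 0 ≤ a ⬝ᵥ b := not_lt.1 fun h => h1 (R.add_mem_of_neg ha hb hab h)
  have e2 : 0 ≤ a ⬝ᵥ c := not_lt.1 fun h => h2 (R.add_mem_of_neg ha hc hac h)
  have e3 : (a + b + c) ⬝ᵥ c ≤ 0 := not_lt.1 fun h => h1 (by
    simpa using R.sub_mem_of_pos habc hc (by simpa using hab) h)
  have e4 : (a + b + c) ⬝ᵥ b ≤ 0 := not_lt.1 fun h => h2 (by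
    have e : a + b + c - b = a + c := by abel
    have ne : a + b + c ≠ b := fun h => hac (by rw [← e, h, sub_self])
    rw [← e]
    exact R.sub_mem_of_pos habc hb ne h)
  have e5 := dotProduct_self_pos_of_ne_zero hbc
  simp only [add_dotProduct, dotProduct_add] at e3 e4 e5
  linarith

/-- If `α` is longer than `μ` and `μ - α` is a root, then `μ - α` is the reflection of `μ`
in `α`, and the squared length of `α` is at least twice that of `μ`. -/
theorem two_mul_dotProduct_of_longer {μ α : Fin n → ℝ} (hμ : μ ∈ R.Δ) (hα : α ∈ R.Δ)
    (hsub : μ - α ∈ R.Δ) (hlt : μ ⬝ᵥ μ < α ⬝ᵥ α) :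
    2 * (μ ⬝ᵥ α) = α ⬝ᵥ α ∧ 2 * (μ ⬝ᵥ μ) ≤ α ⬝ᵥ α := by
  obtain ⟨k, hk⟩ := R.exists_int_mul hα hμ
  obtain ⟨y, hy⟩ := R.exists_int_mul hμ hα
  obtain ⟨z, hz⟩ := R.exists_int_mul hsub hα
  have hM := R.self_pos hμ
  have hA := R.self_pos hα
  have hC := sq_dotProduct_le μ α
  rw [dotProduct_comm α μ] at hk
  rw [sub_dotProduct_sub_self, sub_dotProduct] at hz
  generalize μ ⬝ᵥ μ = M at *
  generalize α ⬝ᵥ α = A at *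
  generalize μ ⬝ᵥ α = m at *
  have hm : m ^ 2 < A ^ 2 := by nlinarith
  have hm' := abs_lt_of_sq_lt_sq' hm hA.le
  have k1 : k < 2 := by
    have : (k : ℝ) < 2 := by nlinarith
    exact_mod_cast this
  have k2 : -2 < k := by
    have : (-2 : ℝ) < k := by nlinarith
    exact_mod_cast this
  have hzz : z ≤ -2 ∨ -1 ≤ z := by omega
  have hzr : (z : ℝ) ≤ -2 ∨ (-1 : ℝ) ≤ z := by exact_mod_cast hzz
  obtain rfl | rfl | rfl : k = -1 ∨ k = 0 ∨ k = 1 := by omega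
  · exfalso
    have : 2 * m = -A := by push_cast at hk; linarith
    rcases hzr with h | h <;> nlinarith
  · exfalso
    have : m = 0 := by push_cast at hk; linarith
    subst this
    rcases hzr with h | h <;> nlinarith
  · have e : 2 * m = A := by push_cast at hk; linarith
    refine ⟨e, ?_⟩
    have y1 : (1 : ℝ) < y := by nlinarith
    have y2 : (2 : ℝ) ≤ y := by exact_mod_cast (show (2 : ℤ) ≤ y by
      have : (1 : ℤ) < y := by exact_mod_cast y1
      omega)
    nlinarith

/-- The simple roots, as a basis of the ambient space. -/
noncomputable def simpleBasis : Module.Basis (Fin n) ℝ (Fin n → ℝ) :=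
  Module.Basis.mk R.sroot_indep
    (R.sroot_indep.span_eq_top_of_card_eq_finrank' (by simp)).ge

theorem coord_sroot (i j : Fin n) :
    R.simpleBasis.coord j (R.sroot i) = if i = j then 1 else 0 := by
  have h : R.simpleBasis i = R.sroot i := by simp [simpleBasis]
  rw [← h, Module.Basis.coord_apply, Module.Basis.repr_self, Finsupp.single_apply]

theorem coord_sum (c : Fin n → ℕ) (j : Fin n) :
    R.simpleBasis.coord j (∑ i, (c i : ℝ) • R.sroot i) = c j := by
  simp only [map_sum, map_smul, coord_sroot]
  simp

theorem exists_nat_of_coord_pos {β : Fin n → ℝ} (hβ : β ∈ R.Δ) {j : Fin n}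
    (hj : 0 < R.simpleBasis.coord j β) : ∃ c : Fin n → ℕ, β = ∑ i, (c i : ℝ) • R.sroot i := by
  rcases R.base β hβ with h | ⟨c, rfl⟩
  · exact h
  · rw [map_neg, coord_sum] at hj
    linarith [(c j).cast_nonneg (α := ℝ)]

theorem mem_graded_one_iff {i₀ : Fin n} {β : Fin n → ℝ} :
    β ∈ graded R {i₀} 1 ↔ β ∈ R.Δ ∧ R.simpleBasis.coord i₀ β = 1 := by
  simp only [graded, Finset.mem_filter, Finset.sum_singleton]
  refine and_congr_right fun hβ => ⟨?_, fun h => ?_⟩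
  · rintro ⟨c, rfl, hc⟩
    rw [coord_sum, hc, Nat.cast_one]
  · obtain ⟨c, rfl⟩ := R.exists_nat_of_coord_pos hβ (j := i₀) (by rw [h]; exact one_pos)
    refine ⟨c, rfl, ?_⟩
    rw [coord_sum] at h
    exact_mod_cast h

theorem sroot_sub_sroot_notMem {i j : Fin n} (hij : i ≠ j) : R.sroot i - R.sroot j ∉ R.Δ := by
  intro h
  obtain ⟨c, hc⟩ := R.exists_nat_of_coord_pos h (j := i) (by
    rw [map_sub, coord_sroot, coord_sroot, if_pos rfl, if_neg hij.symm]; norm_num)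
  have h2 := R.coord_sum c j
  rw [← hc, map_sub, coord_sroot, coord_sroot, if_neg hij, if_pos rfl] at h2
  linarith [(c j).cast_nonneg (α := ℝ)]

theorem sroot_injective : Function.Injective R.sroot :=
  R.sroot_indep.injective

theorem sroot_dotProduct_sroot_nonpos {i j : Fin n} (hij : i ≠ j) :
    R.sroot i ⬝ᵥ R.sroot j ≤ 0 :=
  not_lt.1 fun h => R.sroot_sub_sroot_notMem hij
    (R.sub_mem_of_pos (R.sroot_mem i) (R.sroot_mem j) (R.sroot_injective.ne hij) h)

theorem sub_sroot_dotProduct_sub_sroot_nonpos {μ : Fin n → ℝ} {i j : Fin n} (hij : i ≠ j)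
    (hi : μ - R.sroot i ∈ R.Δ) (hj : μ - R.sroot j ∈ R.Δ) :
    μ ⬝ᵥ μ + R.sroot i ⬝ᵥ R.sroot j ≤ μ ⬝ᵥ R.sroot i + μ ⬝ᵥ R.sroot j := by
  have h : (μ - R.sroot j) ⬝ᵥ (μ - R.sroot i) ≤ 0 := not_lt.1 fun h => by
    have := R.sub_mem_of_pos hj hi
      (fun e => hij (R.sroot_injective (sub_right_injective e).symm)) h
    rw [sub_sub_sub_cancel_left] at this
    exact R.sroot_sub_sroot_notMem hij this
  simp only [sub_dotProduct, dotProduct_sub, dotProduct_comm _ μ,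
    dotProduct_comm (R.sroot j) (R.sroot i)] at h
  linarith

/-- A root of degree one that is a sum of a root of degree one and a positive root of degree
zero is not minimal among the roots of degree one. -/
theorem exists_sub_sroot_mem_of_add {i₀ : Fin n} (N : ℕ) :
    ∀ (a : Fin n → ℝ) (c : Fin n → ℕ), a ∈ R.Δ → R.simpleBasis.coord i₀ a = 1 →
      ∑ i, (c i : ℝ) • R.sroot i ∈ R.Δ → c i₀ = 0 → ∑ i, c i = N →
      a + ∑ i, (c i : ℝ) • R.sroot i ∈ R.Δ →
      ∃ i, i ≠ i₀ ∧ a + ∑ i, (c i : ℝ) • R.sroot i - R.sroot i ∈ R.Δ := by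
  induction N with
  | zero =>
    intro a c _ _ hν _ hN _
    have hc : ∀ i, c i = 0 := by simpa using hN
    exact absurd (by simp [hc]) (R.nonzero _ hν)
  | succ N ih =>
    intro a c ha ha1 hν hc0 hN hsum
    obtain ⟨i, hi⟩ : ∃ i, 0 < (c i : ℝ) *
        ((∑ i, (c i : ℝ) • R.sroot i) ⬝ᵥ R.sroot i) := by
      by_contra! h
      have hs := Finset.sum_nonpos fun i (_ : i ∈ Finset.univ) => h i
      have hp := R.self_pos hν
      rw [dotProduct_sum] at hp
      simp only [dotProduct_smul, smul_eq_mul] at hp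
      linarith
    have hci : c i ≠ 0 := fun h => by simp [h] at hi
    have hip := pos_of_mul_pos_right hi (Nat.cast_nonneg (α := ℝ) (c i))
    have hii : i ≠ i₀ := by rintro rfl; exact hci hc0
    by_cases hνi : ∑ i, (c i : ℝ) • R.sroot i = R.sroot i
    · exact ⟨i, hii, by rw [hνi, add_sub_cancel_right]; exact ha⟩
    let c' : Fin n → ℕ := fun j => c j - if j = i then 1 else 0
    have hcc : ∀ j, c j = c' j + if j = i then 1 else 0 := by
      intro j
      by_cases h : j = i
      · subst h; simp only [c', if_true]; omega
      · simp [c', h]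
    have hc' : ∑ j, (c j : ℝ) • R.sroot j = ∑ j, (c' j : ℝ) • R.sroot j + R.sroot i := by
      simp only [hcc, Nat.cast_add, add_smul, Finset.sum_add_distrib]
      simp
    have hN' : ∑ j, c' j = N := by
      simp only [hcc, Finset.sum_add_distrib] at hN
      simp at hN
      exact hN
    have hc0' : c' i₀ = 0 := by simp [c', hc0]
    have hν' := R.sub_mem_of_pos hν (R.sroot_mem i) hνi hip
    have hνne := R.nonzero _ hν
    rw [hc'] at hsum hν' hνne ⊢
    rw [add_sub_cancel_right] at hν'
    have hai : R.simpleBasis.coord i₀ (a + R.sroot i) = 1 := by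
      rw [map_add, ha1, coord_sroot, if_neg hii, add_zero]
    rcases R.add_mem_or_add_mem ha hν' (R.sroot_mem i) (by rwa [add_assoc]) hνne
      (fun h => by
        have := congrArg (R.simpleBasis.coord i₀) h
        rw [map_add, ha1, coord_sum, hc0'] at this
        simp at this)
      (fun h => by rw [h] at hai; simp at hai) with h | h
    · exact ⟨i, hii, by rwa [← add_assoc, add_sub_cancel_right]⟩
    · obtain ⟨k, hk, hk'⟩ := ih (a + R.sroot i) c' h hai hν' hc0' hN'
        (by rwa [add_assoc, add_comm (R.sroot i)])
      refine ⟨k, hk, ?_⟩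
      rwa [add_comm _ (R.sroot i), ← add_assoc]

/-- The simple root of degree one is the only minimal root of degree one. -/
theorem exists_sub_sroot_mem {i₀ : Fin n} {μ : Fin n → ℝ} (hμ : μ ∈ R.Δ)
    (hμ1 : R.simpleBasis.coord i₀ μ = 1) (hne : μ ≠ R.sroot i₀) :
    ∃ i, i ≠ i₀ ∧ μ - R.sroot i ∈ R.Δ := by
  have ne : ∀ i, i ≠ i₀ → μ ≠ R.sroot i := by
    rintro i hi rfl
    rw [coord_sroot, if_neg hi] at hμ1
    exact zero_ne_one hμ1
  by_contra! h
  have hle : ∀ i, i ≠ i₀ → μ ⬝ᵥ R.sroot i ≤ 0 := fun i hi => not_lt.1 fun hp =>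
    h i hi (R.sub_mem_of_pos hμ (R.sroot_mem i) (ne i hi) hp)
  obtain ⟨c, hc⟩ := R.exists_nat_of_coord_pos hμ (by rw [hμ1]; exact one_pos)
  have hci : c i₀ = 1 := by
    rw [hc, coord_sum] at hμ1
    exact_mod_cast hμ1
  have hp : 0 < μ ⬝ᵥ R.sroot i₀ := by
    by_contra! h0
    have hs : ∑ i, (c i : ℝ) * (μ ⬝ᵥ R.sroot i) ≤ 0 := Finset.sum_nonpos fun i _ =>
      mul_nonpos_of_nonneg_of_nonpos (Nat.cast_nonneg _) (by
        by_cases hi : i = i₀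
        · rw [hi]; exact h0
        · exact hle i hi)
    have e : μ ⬝ᵥ μ = ∑ i, (c i : ℝ) * (μ ⬝ᵥ R.sroot i) := by
      conv_lhs => rw [hc, dotProduct_sum, ← hc]
      simp only [dotProduct_smul, smul_eq_mul]
    linarith [R.self_pos hμ]
  let c' : Fin n → ℕ := fun j => if j = i₀ then 0 else c j
  have hcc : ∀ j, c j = c' j + if j = i₀ then 1 else 0 := by
    intro j
    by_cases h : j = i₀
    · subst h; simp [c', hci]
    · simp [c', h]
  have hμc : μ = R.sroot i₀ + ∑ j, (c' j : ℝ) • R.sroot j := by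
    rw [hc]
    simp only [hcc, Nat.cast_add, add_smul, Finset.sum_add_distrib]
    simp [add_comm]
  have hν := R.sub_mem_of_pos hμ (R.sroot_mem i₀) hne hp
  obtain ⟨i, hi, hi'⟩ := R.exists_sub_sroot_mem_of_add (i₀ := i₀) _ (R.sroot i₀) c'
    (R.sroot_mem i₀) (by rw [coord_sroot, if_pos rfl])
    (by rwa [hμc, add_sub_cancel_left] at hν) (by simp [c']) rfl (hμc ▸ hμ)
  exact h i hi (by rwa [← hμc] at hi')

/-- A root of degree one cannot yield roots on subtracting four distinct simple roots of degree
zero. -/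
theorem not_four_sub_sroot_mem {i₀ : Fin n} {μ : Fin n → ℝ} (hμ : μ ∈ R.Δ)
    (hμ1 : R.simpleBasis.coord i₀ μ = 1) {T : Finset (Fin n)} (hT : T.card = 4)
    (h : ∀ i ∈ T, i ≠ i₀ ∧ μ - R.sroot i ∈ R.Δ) : False := by
  have coord0 : ∀ i ∈ T, R.simpleBasis.coord i₀ (R.sroot i) = 0 := fun i hi => by
    rw [coord_sroot, if_neg (h i hi).1]
  have pair : ∀ i ∈ T, ∀ j ∈ T, i ≠ j →
      μ ⬝ᵥ μ + R.sroot i ⬝ᵥ R.sroot j ≤ μ ⬝ᵥ R.sroot i + μ ⬝ᵥ R.sroot j :=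
    fun i hi j hj hij => R.sub_sroot_dotProduct_sub_sroot_nonpos hij (h i hi).2 (h j hj).2
  have long : ∀ i ∈ T, R.sroot i ⬝ᵥ R.sroot i ≤ μ ⬝ᵥ μ ∨
      (2 * (μ ⬝ᵥ R.sroot i) = R.sroot i ⬝ᵥ R.sroot i ∧
        2 * (μ ⬝ᵥ μ) ≤ R.sroot i ⬝ᵥ R.sroot i) := fun i hi =>
    (le_or_gt _ _).imp_right fun hlt =>
      R.two_mul_dotProduct_of_longer hμ (R.sroot_mem i) (h i hi).2 hlt
  have two : ∀ i ∈ T, ∀ j ∈ T, i ≠ j → 0 < 4 * (μ ⬝ᵥ μ)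
      - 4 * (μ ⬝ᵥ R.sroot i + μ ⬝ᵥ R.sroot j) + R.sroot i ⬝ᵥ R.sroot i
      + R.sroot j ⬝ᵥ R.sroot j + 2 * (R.sroot i ⬝ᵥ R.sroot j) := by
    intro i hi j hj _
    have hne : μ + μ - R.sroot i - R.sroot j ≠ 0 := fun e => by
      have := congrArg (R.simpleBasis.coord i₀) e
      simp only [map_sub, map_add, hμ1, coord0 i hi, coord0 j hj, map_zero] at this
      norm_num at this
    have hp := dotProduct_self_pos_of_ne_zero hne
    simp only [sub_dotProduct, dotProduct_sub, add_dotProduct, dotProduct_add,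
      dotProduct_comm _ μ, dotProduct_comm (R.sroot j) (R.sroot i)] at hp
    linarith
  obtain ⟨p, q, r, t, hpq, hpr, hpt, hqr, hqt, hrt, rfl⟩ := Finset.card_eq_four.1 hT
  have mp : p ∈ ({p, q, r, t} : Finset (Fin n)) := by simp
  have mq : q ∈ ({p, q, r, t} : Finset (Fin n)) := by simp
  have mr : r ∈ ({p, q, r, t} : Finset (Fin n)) := by simp
  have mt : t ∈ ({p, q, r, t} : Finset (Fin n)) := by simp
  have hne : μ + μ - R.sroot p - R.sroot q - R.sroot r - R.sroot t ≠ 0 := fun e => by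
    have := congrArg (R.simpleBasis.coord i₀) e
    simp only [map_sub, map_add, hμ1, coord0 _ mp, coord0 _ mq, coord0 _ mr, coord0 _ mt,
      map_zero] at this
    norm_num at this
  have hp := dotProduct_self_pos_of_ne_zero hne
  simp only [sub_dotProduct, dotProduct_sub, add_dotProduct, dotProduct_add,
    dotProduct_comm _ μ, dotProduct_comm (R.sroot q) (R.sroot p),
    dotProduct_comm (R.sroot r) (R.sroot p), dotProduct_comm (R.sroot t) (R.sroot p),
    dotProduct_comm (R.sroot r) (R.sroot q), dotProduct_comm (R.sroot t) (R.sroot q),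
    dotProduct_comm (R.sroot t) (R.sroot r)] at hp
  have hM := R.self_pos hμ
  have o1 := R.sroot_dotProduct_sroot_nonpos hpq
  have o2 := R.sroot_dotProduct_sroot_nonpos hpr
  have o3 := R.sroot_dotProduct_sroot_nonpos hpt
  have o4 := R.sroot_dotProduct_sroot_nonpos hqr
  have o5 := R.sroot_dotProduct_sroot_nonpos hqt
  have o6 := R.sroot_dotProduct_sroot_nonpos hrt
  have w1 := two _ mp _ mq hpq
  have w2 := two _ mp _ mr hpr
  have w3 := two _ mp _ mt hpt
  have w4 := two _ mq _ mr hqr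
  have w5 := two _ mq _ mt hqt
  have w6 := two _ mr _ mt hrt
  have v1 := pair _ mp _ mq hpq
  have v2 := pair _ mp _ mr hpr
  have v3 := pair _ mp _ mt hpt
  have v4 := pair _ mq _ mr hqr
  have v5 := pair _ mq _ mt hqt
  have v6 := pair _ mr _ mt hrt
  rcases long _ mp with lp | ⟨lp, lp'⟩ <;> rcases long _ mq with lq | ⟨lq, lq'⟩ <;>
    rcases long _ mr with lr | ⟨lr, lr'⟩ <;> rcases long _ mt with lt | ⟨lt, lt'⟩ <;>
    linarith

/-- The number of elements of `Δ(1)` covered by `μ`. -/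
noncomputable def coverCount (s : Finset (Fin n)) (μ : Fin n → ℝ) : ℕ :=
  ((sᶜ : Finset (Fin n)).filter (fun i => μ - R.sroot i ∈ graded R s 1)).card

theorem coverCount_le_three {i₀ : Fin n} {μ : Fin n → ℝ} (hμ : μ ∈ graded R {i₀} 1) :
    R.coverCount {i₀} μ ≤ 3 := by
  rw [mem_graded_one_iff] at hμ
  by_contra! h
  obtain ⟨T, hT, hT4⟩ := Finset.exists_subset_card_eq (Nat.succ_le_of_lt h)
  refine R.not_four_sub_sroot_mem hμ.1 hμ.2 hT4 fun i hi => ?_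
  have := hT hi
  rw [Finset.mem_filter, mem_graded_one_iff] at this
  exact ⟨by simpa using this.1, this.2.1⟩

theorem coverCount_eq_zero_iff {i₀ : Fin n} {μ : Fin n → ℝ} (hμ : μ ∈ graded R {i₀} 1) :
    R.coverCount {i₀} μ = 0 ↔ μ = R.sroot i₀ := by
  rw [coverCount, Finset.card_eq_zero, Finset.filter_eq_empty_iff]
  rw [mem_graded_one_iff] at hμ
  constructor
  · intro h
    by_contra hne
    obtain ⟨i, hi, hi'⟩ := R.exists_sub_sroot_mem hμ.1 hμ.2 hne
    refine h (x := i) (by simpa using hi) (R.mem_graded_one_iff.2 ⟨hi', ?_⟩)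
    rw [map_sub, hμ.2, coord_sroot, if_neg hi, sub_zero]
  · rintro rfl i hi h
    exact R.sroot_sub_sroot_notMem (by simpa [eq_comm] using hi) (R.mem_graded_one_iff.1 h).1

theorem ucpCoeff_eq_card (s : Finset (Fin n)) (j : ℕ) :
    ucpCoeff R s j = ((graded R s 1).filter fun μ => R.coverCount s μ = j).card :=
  rfl

theorem ucpCoeff_zero (i₀ : Fin n) : ucpCoeff R {i₀} 0 = 1 := by
  rw [ucpCoeff_eq_card, Finset.card_eq_one]
  refine ⟨R.sroot i₀, ?_⟩
  ext μ
  rw [Finset.mem_filter, Finset.mem_singleton]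
  constructor
  · rintro ⟨hμ, h⟩
    exact (R.coverCount_eq_zero_iff hμ).1 h
  · rintro rfl
    have hm : R.sroot i₀ ∈ graded R {i₀} 1 :=
      R.mem_graded_one_iff.2 ⟨R.sroot_mem i₀, by rw [coord_sroot, if_pos rfl]⟩
    exact ⟨hm, (R.coverCount_eq_zero_iff hm).2 rfl⟩

theorem card_gradedEdges (s : Finset (Fin n)) :
    (gradedEdges R s 1).card = ∑ μ ∈ graded R s 1, R.coverCount s μ := by
  simp only [gradedEdges, coverCount, Finset.card_filter, Finset.sum_product]

end SimpleRootSystem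

/-- For a (1-standard) `ℤ`-grading of a simple Lie algebra `g`, the upper covering
polynomial of `Δ(1)` has degree at most `3`, i.e. `K(t) = a₀ + a₁t + a₂t² + a₃t³`,
and `2·dim g(1) − #E(1) = 2 + a₁ − a₃`. -/
theorem ucp_degree_le_three_and_formula (n : ℕ) (hn : 0 < n) (R : SimpleRootSystem n)
    (s : Finset (Fin n)) (hs : s.card = 1) :
    (∀ j, 4 ≤ j → ucpCoeff R s j = 0) ∧
    (2 * ((graded R s 1).card : ℤ) - ((gradedEdges R s 1).card : ℤ)
      = 2 + (ucpCoeff R s 1 : ℤ) - (ucpCoeff R s 3 : ℤ)) := by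
  obtain ⟨i₀, rfl⟩ := Finset.card_eq_one.1 hs
  constructor
  · intro j hj
    rw [R.ucpCoeff_eq_card, Finset.card_eq_zero, Finset.filter_eq_empty_iff]
    intro μ hμ h
    have := R.coverCount_le_three hμ
    omega
  · have key : 2 * ((graded R {i₀} 1).card : ℤ) - ((gradedEdges R {i₀} 1).card : ℤ)
        = 2 * (ucpCoeff R {i₀} 0 : ℤ) + (ucpCoeff R {i₀} 1 : ℤ)
          - (ucpCoeff R {i₀} 3 : ℤ) := by
      simp only [R.ucpCoeff_eq_card, R.card_gradedEdges, Finset.card_filter, Nat.cast_sum,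
        Finset.card_eq_sum_ones (graded R {i₀} 1), Finset.mul_sum, ← Finset.sum_sub_distrib,
        ← Finset.sum_add_distrib]
      refine Finset.sum_congr rfl fun μ hμ => ?_
      have := R.coverCount_le_three hμ
      generalize R.coverCount {i₀} μ = d at *
      interval_cases d <;> simp
    rw [key, R.ucpCoeff_zero]
    norm_num
end
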